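/- Let (e_j, f_j), j = 1, …, m, be pairwise orthogonal hyperbolic pairs. Then the element X := Σ_{j=1}^m (1 − ι e_j * ι f_j) commutes with the element E := Σ_{i=1}^{m−1} ι e_{i+1} * ι f_i in the Clifford algebra: X * E = E * X. (This is the commutation used to show that the loop ∏_j exp(iθ(1 − e_j f_j)/2), joining I to −I, centralizes the nilpotent representative e = (e₂f₁ + ⋯ + e_m f_{m−1})/2.) -/

import Mathlib

open CliffordAlgebra QuadraticMap

/-- The commutator of a product of two vectors with a third vector is a vector. -/
theorem CliffordAlgebra.ι_mul_ι_mul_ι_eq {R M : Type*} [CommRing R] [AddCommGroup M] [Module R M]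
    (Q : QuadraticForm R M) (a b v : M) :
    ι Q a * ι Q b * ι Q v =
      ι Q v * (ι Q a * ι Q b) + (polar Q b v • ι Q a - polar Q a v • ι Q b) := by
  have hb : ι Q b * ι Q v = algebraMap R _ (polar Q b v) - ι Q v * ι Q b :=
    eq_sub_of_add_eq (ι_mul_ι_add_swap b v)
  have ha : ι Q a * ι Q v = algebraMap R _ (polar Q a v) - ι Q v * ι Q a :=
    eq_sub_of_add_eq (ι_mul_ι_add_swap a v)
  rw [mul_assoc, hb, mul_sub, ← mul_assoc (ι Q a), ha, sub_mul, mul_assoc, ← Algebra.commutes,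
    ← Algebra.smul_def, ← Algebra.smul_def]
  abel

/-- The commutator of a sum of products of two vectors with a vector. -/
theorem CliffordAlgebra.sum_ι_mul_ι_mul_ι_eq {R M J : Type*} [CommRing R] [AddCommGroup M]
    [Module R M] [Fintype J] (Q : QuadraticForm R M) (a b : J → M) (v : M) :
    (∑ j, ι Q (a j) * ι Q (b j)) * ι Q v = ι Q v * (∑ j, ι Q (a j) * ι Q (b j)) +
      ∑ j, (polar Q (b j) v • ι Q (a j) - polar Q (a j) v • ι Q (b j)) := by
  simp only [Finset.sum_mul, Finset.mul_sum, ← Finset.sum_add_distrib, ι_mul_ι_mul_ι_eq]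

/-- Let `(e j, f j)`, `j = 0, …, n`, be pairwise orthogonal hyperbolic pairs.  Then
`X = ∑ j (1 - ι (e j) * ι (f j))` commutes with the nilpotent representative
`E = ∑ i (ι (e (i+1)) * ι (f i))` in the Clifford algebra. -/
theorem cartan_sum_commutes_with_nilpotent {V : Type*} [AddCommGroup V] [Module ℂ V]
    (Q : QuadraticForm ℂ V) (n : ℕ) (e f : Fin (n + 1) → V)
    (hQe : ∀ j, Q (e j) = 0) (hQf : ∀ j, Q (f j) = 0)
    (hef : ∀ j, polar Q (e j) (f j) = 2)
    (horth : ∀ i j, i ≠ j →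
      polar Q (e i) (e j) = 0 ∧ polar Q (e i) (f j) = 0 ∧ polar Q (f i) (f j) = 0)
    (X E : CliffordAlgebra Q)
    (hX : X = ∑ j : Fin (n + 1), (1 - ι Q (e j) * ι Q (f j)))
    (hE : E = ∑ i : Fin n, ι Q (e i.succ) * ι Q (f i.castSucc)) :
    X * E = E * X := by
  have he (k : Fin (n + 1)) : (∑ j, ι Q (e j) * ι Q (f j)) * ι Q (e k) =
      ι Q (e k) * (∑ j, ι Q (e j) * ι Q (f j)) + (2 : ℂ) • ι Q (e k) := by
    rw [sum_ι_mul_ι_mul_ι_eq, add_right_inj, Fintype.sum_eq_single k]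
    · simp [polar_comm Q (f k), hef, polar_self, hQe]
    · intro j hj
      simp [polar_comm Q (f j), horth k j hj.symm, horth j k hj]
  have hf (k : Fin (n + 1)) : (∑ j, ι Q (e j) * ι Q (f j)) * ι Q (f k) =
      ι Q (f k) * (∑ j, ι Q (e j) * ι Q (f j)) - (2 : ℂ) • ι Q (f k) := by
    rw [sum_ι_mul_ι_mul_ι_eq, sub_eq_add_neg, add_right_inj, Fintype.sum_eq_single k]
    · simp [hef, polar_self, hQf]
    · intro j hj
      simp [horth j k hj]
  have hcomm : Commute (∑ j, ι Q (e j) * ι Q (f j)) E := by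
    rw [hE]
    refine Commute.sum_right _ _ _ fun i _ => ?_
    rw [commute_iff_eq, ← mul_assoc, he, add_mul, mul_assoc, hf, mul_sub, smul_mul_assoc,
      mul_smul_comm, sub_add_cancel, mul_assoc]
  rw [hX, Finset.sum_sub_distrib]
  exact (Commute.sum_left _ _ _ fun _ _ => Commute.one_left E).sub_left hcomm
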